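/- Let g be an invertible element of C⁺(V) and r a nonzero rational number. Then τ(g)·g = r·1 if and only if ⟨g·u, g·v⟩_λ = r·⟨u, v⟩_λ for all u, v ∈ C⁺(V). In particular, an invertible g ∈ C⁺(V) acts by left multiplication as a symplectic similitude of ⟨,⟩_λ exactly when τ(g)g is a nonzero scalar. -/

import Mathlib

open CliffordAlgebra

set_option synthInstance.maxHeartbeats 1000000
set_option maxHeartbeats 2000000

noncomputable section

variable (n : ℕ) (a : Fin (n + 2) → ℚ)

/-- The quadratic form `Q(x) = -a₁x₁² - a₂x₂² + a₃x₃² + ⋯ + a_{n+2}x_{n+2}²` on `V = ℚ^{n+2}`. -/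
def Qf : QuadraticForm ℚ (Fin (n + 2) → ℚ) :=
  QuadraticMap.weightedSumSquares ℚ (fun i => if (i : ℕ) < 2 then -a i else a i)

/-- The standard basis vectors `eᵢ` of `V`, viewed inside the Clifford algebra `C(V)`. -/
def e (i : Fin (n + 2)) : CliffordAlgebra (Qf n a) := ι (Qf n a) (Pi.single i 1)

/-- The even Clifford algebra `C⁺(V)`. -/
abbrev Cplus : Subalgebra ℚ (CliffordAlgebra (Qf n a)) := even (Qf n a)

/-- The reversal anti-automorphism `τ`, restricted to the even Clifford algebra. -/
def tau (x : Cplus n a) : Cplus n a :=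
  ⟨reverse (Q := Qf n a) (x : CliffordAlgebra (Qf n a)), by
    have hx : (x : CliffordAlgebra (Qf n a)) ∈ evenOdd (Qf n a) 0 := x.2
    exact (reverse_mem_evenOdd_iff (Q := Qf n a)).mpr hx⟩

/-- `tr z` is the trace of the ℚ-linear endomorphism `x ↦ z * x` of `C⁺(V)`. -/
def tr (z : Cplus n a) : ℚ := LinearMap.trace ℚ (Cplus n a) (LinearMap.mulLeft ℚ z)

/-- `λ := e₁e₂ ∈ C⁺(V)`. -/
def lam : Cplus n a := ⟨e n a 0 * e n a 1, ι_mul_ι_mem_evenOdd_zero (Qf n a) _ _⟩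

/-- `λ⁻¹ = -(a₁a₂)⁻¹·λ`. -/
def lamInv : Cplus n a := (-(a 0 * a 1)⁻¹) • lam n a


/-- The bilinear form `⟨x,y⟩_λ := tr(λ·τ(x)·y)` on `C⁺(V)`. -/
def form (x y : Cplus n a) : ℚ := tr n a (lam n a * tau n a x * y)

/-- The diagonal weights. -/
def wt (i : Fin (n + 2)) : ℚ := if (i : ℕ) < 2 then -a i else a i

/-- Ordered monomials along a list. -/
def mono (L : List (Fin (n + 2))) (S : Finset (Fin (n + 2))) : CliffordAlgebra (Qf n a) :=
  ((L.filter (fun i => decide (i ∈ S))).map (e n a)).prod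

theorem wt_ne (ha : ∀ i, 0 < a i) (i : Fin (n + 2)) : wt n a i ≠ 0 := by
  unfold wt
  have := ha i
  split_ifs
  · exact neg_ne_zero.mpr this.ne'
  · exact this.ne'

theorem e_sq (i : Fin (n + 2)) : e n a i * e n a i = algebraMap ℚ _ (wt n a i) := by
  unfold e
  rw [ι_sq_scalar]
  congr 1
  simp [Qf, wt, QuadraticMap.weightedSumSquares_apply, Pi.single_apply]

theorem e_anti {i j : Fin (n + 2)} (h : i ≠ j) : e n a i * e n a j = -(e n a j * e n a i) := by
  unfold e
  apply ι_mul_ι_comm_of_isOrtho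
  rw [QuadraticMap.isOrtho_def]
  simp only [Qf, QuadraticMap.weightedSumSquares_apply]
  rw [← Finset.sum_add_distrib]
  refine Finset.sum_congr rfl fun k _ => ?_
  have : (Pi.single i 1 : Fin (n + 2) → ℚ) k * (Pi.single j 1 : Fin (n + 2) → ℚ) k = 0 := by
    by_cases hk : k = i
    · subst hk; simp [Pi.single_apply, h]
    · simp [Pi.single_apply, hk]
  simp only [Pi.add_apply, smul_eq_mul]
  linear_combination (2 * if (k : ℕ) < 2 then -a k else a k) * this

theorem e_sq_mul (i : Fin (n + 2)) (x : CliffordAlgebra (Qf n a)) :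
    e n a i * (e n a i * x) = wt n a i • x := by
  rw [← mul_assoc, e_sq, Algebra.smul_def]

theorem e_anti_mul {i j : Fin (n + 2)} (h : i ≠ j) (x : CliffordAlgebra (Qf n a)) :
    e n a i * (e n a j * x) = -(e n a j * (e n a i * x)) := by
  rw [← mul_assoc, e_anti n a h, neg_mul, mul_assoc]

theorem e_cancel (ha : ∀ i, 0 < a i) (i : Fin (n + 2)) (x : CliffordAlgebra (Qf n a))
    (h : e n a i * x = 0) : x = 0 := by
  have h2 := e_sq_mul n a i x
  rw [h, mul_zero] at h2
  exact (smul_eq_zero.mp h2.symm).resolve_left (wt_ne n a ha i)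

theorem mono_nil (S) : mono n a [] S = 1 := by simp [mono]

theorem mono_cons_mem {j L} {S : Finset (Fin (n + 2))} (h : j ∈ S) :
    mono n a (j :: L) S = e n a j * mono n a L S := by
  simp [mono, h]

theorem mono_cons_not {j L} {S : Finset (Fin (n + 2))} (h : j ∉ S) :
    mono n a (j :: L) S = mono n a L S := by
  simp [mono, h]

theorem mono_congr {L} {S T : Finset (Fin (n + 2))} (h : ∀ j ∈ L, j ∈ S ↔ j ∈ T) :
    mono n a L S = mono n a L T := by
  unfold mono
  congr 2
  apply List.filter_congr
  intro j hj
  simp [h j hj]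

theorem e_mul_mono (ha : ∀ i, 0 < a i) (i : Fin (n + 2)) (L : List (Fin (n + 2)))
    (hL : L.Nodup) (hi : i ∈ L) (S : Finset (Fin (n + 2))) :
    ∃ c : ℚ, c ≠ 0 ∧ ∃ T, (∀ j, j ≠ i → (j ∈ S ↔ j ∈ T)) ∧ (i ∈ S ↔ i ∉ T) ∧
      e n a i * mono n a L S = c • mono n a L T := by
  induction L with
  | nil => simp at hi
  | cons j L ih =>
    rw [List.nodup_cons] at hL
    by_cases hij : j = i
    · subst hij
      by_cases hS : j ∈ S
      · refine ⟨wt n a j, wt_ne n a ha j, S.erase j, ?_, ?_, ?_⟩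
        · intro k hk; simp [hk]
        · simp [hS]
        · rw [mono_cons_mem n a hS, mono_cons_not n a (by simp), e_sq_mul]
          congr 1
          apply mono_congr
          intro k hk
          have : k ≠ j := by rintro rfl; exact hL.1 hk
          simp [this]
      · refine ⟨1, one_ne_zero, insert j S, ?_, ?_, ?_⟩
        · intro k hk; simp [hk]
        · simp [hS]
        · rw [mono_cons_not n a hS, mono_cons_mem n a (by simp), one_smul]
          congr 1
          apply mono_congr
          intro k hk
          have : k ≠ j := by rintro rfl; exact hL.1 hk
          simp [this]
    · have hi' : i ∈ L := by
        rcases List.mem_cons.mp hi with h | h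
        · exact absurd h.symm hij
        · exact h
      obtain ⟨c, hc, T, h1, h2, h3⟩ := ih hL.2 hi'
      by_cases hS : j ∈ S
      · refine ⟨-c, neg_ne_zero.mpr hc, T, h1, h2, ?_⟩
        rw [mono_cons_mem n a hS, mono_cons_mem n a ((h1 j hij).mp hS),
          e_anti_mul n a (Ne.symm hij), h3, mul_smul_comm, neg_smul]
      · refine ⟨c, hc, T, h1, h2, ?_⟩
        rw [mono_cons_not n a hS, mono_cons_not n a (fun h => hS ((h1 j hij).mpr h)), h3]

theorem invol_e (i : Fin (n + 2)) : involute (e n a i) = -e n a i := by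
  simp [e]

theorem rev_e (i : Fin (n + 2)) : reverse (e n a i) = e n a i := by
  simp [e]

theorem sign_not (i : Fin (n + 2)) (L : List (Fin (n + 2))) (hi : i ∉ L)
    (S : Finset (Fin (n + 2))) :
    e n a i * involute (mono n a L S) = mono n a L S * e n a i := by
  induction L with
  | nil => simp [mono_nil]
  | cons j L ih =>
    simp only [List.mem_cons, not_or] at hi
    by_cases hS : j ∈ S
    · rw [mono_cons_mem n a hS, map_mul, invol_e, neg_mul, mul_neg, e_anti_mul n a hi.1, neg_neg,
        ih hi.2, mul_assoc]
    · rw [mono_cons_not n a hS, ih hi.2]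

/-- The sign character. -/
def sg (S : Finset (Fin (n + 2))) (i : Fin (n + 2)) : ℚ := if i ∈ S then -1 else 1

theorem sign_mem (i : Fin (n + 2)) (L : List (Fin (n + 2))) (hL : L.Nodup) (hi : i ∈ L)
    (S : Finset (Fin (n + 2))) :
    e n a i * involute (mono n a L S) = sg n S i • (mono n a L S * e n a i) := by
  induction L with
  | nil => simp at hi
  | cons j L ih =>
    rw [List.nodup_cons] at hL
    by_cases hij : j = i
    · subst hij
      by_cases hS : j ∈ S
      · rw [mono_cons_mem n a hS, map_mul, invol_e, neg_mul, mul_neg, sign_not n a j L hL.1]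
        simp [sg, hS, mul_assoc]
      · rw [mono_cons_not n a hS, sign_not n a j L hL.1]
        simp [sg, hS]
    · have hi' : i ∈ L := by
        rcases List.mem_cons.mp hi with h | h
        · exact absurd h.symm hij
        · exact h
      by_cases hS : j ∈ S
      · rw [mono_cons_mem n a hS, map_mul, invol_e, neg_mul, mul_neg,
          e_anti_mul n a (Ne.symm hij), neg_neg, ih hL.2 hi', mul_smul_comm, mul_assoc]
      · rw [mono_cons_not n a hS, ih hL.2 hi']

theorem mono_mul_rev (ha : ∀ i, 0 < a i) (L : List (Fin (n + 2))) (S : Finset (Fin (n + 2))) :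
    ∃ c : ℚ, c ≠ 0 ∧ mono n a L S * reverse (mono n a L S) = algebraMap ℚ _ c := by
  induction L with
  | nil => exact ⟨1, one_ne_zero, by simp [mono_nil]⟩
  | cons j L ih =>
    obtain ⟨c, hc, h⟩ := ih
    by_cases hS : j ∈ S
    · refine ⟨c * wt n a j, mul_ne_zero hc (wt_ne n a ha j), ?_⟩
      rw [mono_cons_mem n a hS, reverse.map_mul, rev_e]
      calc _ = e n a j * ((mono n a L S * reverse (mono n a L S)) * e n a j) := by
            simp only [mul_assoc]
        _ = _ := by
            rw [h, ← Algebra.smul_def, mul_smul_comm, e_sq, map_mul, Algebra.smul_def]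
    · exact ⟨c, hc, by rw [mono_cons_not n a hS, h]⟩

/-- Full monomials. -/
def mon (S : Finset (Fin (n + 2))) : CliffordAlgebra (Qf n a) := mono n a (List.finRange (n + 2)) S

/-- Span of the even monomials. -/
def W : Submodule ℚ (CliffordAlgebra (Qf n a)) :=
  Submodule.span ℚ (Set.range fun S : {S // mon n a S ∈ evenOdd (Qf n a) 0} => mon n a S.1)

theorem iota_sum (m : Fin (n + 2) → ℚ) : ι (Qf n a) m = ∑ i, m i • e n a i := by
  unfold e
  simp only [← map_smul, ← map_sum]
  congr 1
  ext j
  simp [Finset.sum_apply, Pi.single_apply]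

theorem ee_mem_W (ha : ∀ i, 0 < a i) (i j : Fin (n + 2)) (x : CliffordAlgebra (Qf n a))
    (hx : x ∈ W n a) : e n a i * e n a j * x ∈ W n a := by
  unfold W at hx
  induction hx using Submodule.span_induction with
  | mem x hx =>
    obtain ⟨⟨S, hS⟩, rfl⟩ := hx
    obtain ⟨c, hc, T, -, -, h⟩ := e_mul_mono n a ha j _ (List.nodup_finRange _)
      (List.mem_finRange j) S
    obtain ⟨d, hd, U, -, -, h'⟩ := e_mul_mono n a ha i _ (List.nodup_finRange _)
      (List.mem_finRange i) T
    have key : e n a i * e n a j * mon n a S = (c * d) • mon n a U := by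
      unfold mon
      rw [mul_assoc, h, mul_smul_comm, h', smul_smul]
    have hU : mon n a U ∈ evenOdd (Qf n a) 0 := by
      have h1 : e n a i * e n a j * mon n a S ∈ evenOdd (Qf n a) 0 :=
        (even (Qf n a)).mul_mem (ι_mul_ι_mem_evenOdd_zero (Qf n a) _ _) hS
      rw [key] at h1
      exact (Submodule.smul_mem_iff _ (mul_ne_zero hc hd)).mp h1
    simp only [key]
    exact Submodule.smul_mem _ _ (Submodule.subset_span ⟨⟨U, hU⟩, rfl⟩)
  | zero => rw [mul_zero]; exact zero_mem _
  | add x y _ _ hx hy => rw [mul_add]; exact add_mem hx hy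
  | smul c x _ hx => rw [mul_smul_comm]; exact Submodule.smul_mem _ _ hx

theorem mon_empty : mon n a ∅ = 1 := by simp [mon, mono]

theorem even_le_W (ha : ∀ i, 0 < a i) (x : CliffordAlgebra (Qf n a))
    (hx : x ∈ evenOdd (Qf n a) 0) : x ∈ W n a := by
  induction x, hx using even_induction with
  | algebraMap r =>
    rw [Algebra.algebraMap_eq_smul_one]
    refine Submodule.smul_mem _ _ (Submodule.subset_span ⟨⟨∅, ?_⟩, mon_empty n a⟩)
    rw [mon_empty]
    exact (even (Qf n a)).one_mem
  | add x y _ _ hx hy => exact add_mem hx hy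
  | ι_mul_ι_mul m₁ m₂ x _ hx =>
    rw [iota_sum, iota_sum, Finset.sum_mul_sum, Finset.sum_mul]
    refine sum_mem fun i _ => ?_
    rw [Finset.sum_mul]
    refine sum_mem fun j _ => ?_
    rw [smul_mul_smul_comm, smul_mul_assoc]
    exact Submodule.smul_mem _ _ (ee_mem_W n a ha i j x hx)

theorem fin_Cplus (ha : ∀ i, 0 < a i) : Module.Finite ℚ (Cplus n a) := by
  have h1 : Module.Finite ℚ (W n a) :=
    FiniteDimensional.span_of_finite ℚ (Set.finite_range _)
  exact Submodule.finiteDimensional_of_le (S₁ := evenOdd (Qf n a) 0) (even_le_W n a ha)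

/-- Conjugation by `e i` on the even part. -/
def phi (i : Fin (n + 2)) : Cplus n a →ₗ[ℚ] Cplus n a where
  toFun x := ⟨(wt n a i)⁻¹ • (e n a i * x * e n a i), by
    refine Subalgebra.smul_mem _ ?_ _
    have h1 : e n a i ∈ evenOdd (Qf n a) 1 := ι_mem_evenOdd_one _ _
    have h2 : (x : CliffordAlgebra (Qf n a)) ∈ evenOdd (Qf n a) 0 := x.2
    have h3 := SetLike.mul_mem_graded (SetLike.mul_mem_graded h1 h2) h1
    exact h3⟩
  map_add' x y := by ext; simp [mul_add, add_mul]
  map_smul' c x := by ext; simp [smul_comm c]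

theorem phi_mul (ha : ∀ i, 0 < a i) (i : Fin (n + 2)) (x y : Cplus n a) :
    phi n a i (x * y) = phi n a i x * phi n a i y := by
  ext
  have hw := wt_ne n a ha i
  simp only [phi, LinearMap.coe_mk, AddHom.coe_mk, MulMemClass.coe_mul]
  rw [smul_mul_smul_comm]
  simp only [mul_assoc]
  rw [e_sq_mul, mul_smul_comm, mul_smul_comm, smul_smul]
  congr 1
  field_simp

theorem phi_phi (ha : ∀ i, 0 < a i) (i : Fin (n + 2)) : Function.Involutive (phi n a i) := by
  intro x
  ext
  have hw := wt_ne n a ha i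
  simp only [phi, LinearMap.coe_mk, AddHom.coe_mk, mul_smul_comm, smul_mul_assoc]
  simp only [mul_assoc]
  rw [e_sq_mul, e_sq, ← Algebra.commutes, ← Algebra.smul_def, smul_smul, smul_smul, smul_smul]
  convert one_smul ℚ (x : CliffordAlgebra (Qf n a)) using 2
  field_simp

theorem tr_phi (ha : ∀ i, 0 < a i) (i : Fin (n + 2)) (x : Cplus n a) :
    tr n a (phi n a i x) = tr n a x := by
  unfold tr
  rw [← LinearMap.trace_conj' (LinearMap.mulLeft ℚ x)
    (LinearEquiv.ofInvolutive (phi n a i) (phi_phi n a ha i))]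
  congr 1
  ext1 y
  rw [LinearEquiv.conj_apply_apply]
  have : (LinearEquiv.ofInvolutive (phi n a i) (phi_phi n a ha i)).symm y = phi n a i y := rfl
  rw [this]
  change _ = phi n a i (x * phi n a i y)
  rw [phi_mul n a ha, phi_phi n a ha i y]
  rfl

theorem phi_mon (ha : ∀ i, 0 < a i) (i : Fin (n + 2)) (S) (hS : mon n a S ∈ evenOdd (Qf n a) 0) :
    phi n a i ⟨mon n a S, hS⟩ = sg n S i • ⟨mon n a S, hS⟩ := by
  ext
  have h := sign_mem n a i _ (List.nodup_finRange _) (List.mem_finRange i) S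
  change e n a i * involute (mon n a S) = sg n S i • (mon n a S * e n a i) at h
  rw [involute_eq_of_mem_even hS] at h
  simp only [phi, LinearMap.coe_mk, AddHom.coe_mk]
  rw [h, smul_mul_assoc, mul_assoc, e_sq, ← Algebra.commutes, ← Algebra.smul_def, smul_smul,
    smul_smul]
  change _ = sg n S i • mon n a S
  congr 1
  have hw := wt_ne n a ha i
  field_simp

theorem tau_phi (i : Fin (n + 2)) (x : Cplus n a) :
    tau n a (phi n a i x) = phi n a i (tau n a x) := by
  ext
  simp only [phi, tau, LinearMap.coe_mk, AddHom.coe_mk, map_smul, reverse.map_mul, rev_e, mul_assoc]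

theorem tau_smul (c : ℚ) (x : Cplus n a) : tau n a (c • x) = c • tau n a x := by
  ext
  simp [tau]

theorem tau_mul (x y : Cplus n a) : tau n a (x * y) = tau n a y * tau n a x := by
  ext
  simp [tau]

theorem tau_one : tau n a 1 = 1 := by
  ext
  simp [tau]

theorem tr_smul (c : ℚ) (x : Cplus n a) : tr n a (c • x) = c * tr n a x := by
  unfold tr
  have : LinearMap.mulLeft ℚ (c • x) = c • LinearMap.mulLeft ℚ x := by
    ext1 y; simp [smul_mul_assoc]
  rw [this, map_smul, smul_eq_mul]

theorem tr_add (x y : Cplus n a) : tr n a (x + y) = tr n a x + tr n a y := by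
  unfold tr
  have : LinearMap.mulLeft ℚ (x + y) = LinearMap.mulLeft ℚ x + LinearMap.mulLeft ℚ y := by
    ext1 z; simp [add_mul]
  rw [this, map_add]

/-- The trace as a linear map. -/
def trL : Cplus n a →ₗ[ℚ] ℚ where
  toFun := tr n a
  map_add' := tr_add n a
  map_smul' c x := tr_smul n a c x

theorem tr_one (ha : ∀ i, 0 < a i) : tr n a 1 ≠ 0 := by
  have := fin_Cplus n a ha
  unfold tr
  rw [LinearMap.mulLeft_one, LinearMap.trace_id]
  have h : 0 < Module.finrank ℚ (Cplus n a) := Module.finrank_pos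
  exact_mod_cast h.ne'

theorem tr_orth (ha : ∀ i, 0 < a i) (S T) (hS : mon n a S ∈ evenOdd (Qf n a) 0)
    (hT : mon n a T ∈ evenOdd (Qf n a) 0) (hne : S ≠ T) :
    tr n a ((⟨mon n a S, hS⟩ : Cplus n a) * tau n a ⟨mon n a T, hT⟩) = 0 := by
  obtain ⟨i, hi⟩ : ∃ i, ¬ (i ∈ S ↔ i ∈ T) := by
    by_contra h
    push Not at h
    exact hne (Finset.ext h)
  have h := tr_phi n a ha i ((⟨mon n a S, hS⟩ : Cplus n a) * tau n a ⟨mon n a T, hT⟩)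
  rw [phi_mul n a ha, ← tau_phi, phi_mon n a ha, phi_mon n a ha, tau_smul, smul_mul_smul_comm,
    tr_smul] at h
  have hs : sg n S i * sg n T i = -1 := by
    unfold sg
    by_cases h1 : i ∈ S <;> by_cases h2 : i ∈ T <;> simp_all
  rw [hs] at h
  linarith

theorem nondeg (ha : ∀ i, 0 < a i) (x : Cplus n a) (hx : ∀ y, tr n a (x * y) = 0) : x = 0 := by
  classical
  have hW := even_le_W n a ha x x.2
  unfold W at hW
  obtain ⟨c, hc⟩ := (Submodule.mem_span_range_iff_exists_fun ℚ).mp hW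
  have hx' : x = ∑ S : {S // mon n a S ∈ evenOdd (Qf n a) 0},
      c S • (⟨mon n a S.1, S.2⟩ : Cplus n a) := by
    apply Subtype.ext
    rw [← hc]
    simp
  have hc0 : ∀ T, c T = 0 := by
    intro T
    have h := hx (tau n a ⟨mon n a T.1, T.2⟩)
    change trL n a _ = 0 at h
    rw [hx', Finset.sum_mul, map_sum, Finset.sum_eq_single T] at h
    · rw [smul_mul_assoc, map_smul] at h
      obtain ⟨d, hd, hd'⟩ := mono_mul_rev n a ha (List.finRange (n + 2)) T.1
      have h1 : (⟨mon n a T.1, T.2⟩ : Cplus n a) * tau n a ⟨mon n a T.1, T.2⟩ = d • 1 := by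
        apply Subtype.ext
        change mon n a T.1 * reverse (mon n a T.1) = d • 1
        rw [← Algebra.algebraMap_eq_smul_one]
        exact hd'
      rw [h1, map_smul] at h
      have h2 : trL n a 1 ≠ 0 := tr_one n a ha
      simpa [hd, h2] using h
    · intro S _ hST
      rw [smul_mul_assoc, map_smul]
      change c S • tr n a _ = 0
      rw [tr_orth n a ha _ _ S.2 T.2 (fun h => hST (Subtype.ext h)), smul_zero]
    · simp
  rw [hx']
  simp [hc0]

/-- For `g ∈ C⁺(V)` invertible and `r ∈ ℚ` nonzero: `τ(g)·g = r·1` if and only if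
`⟨g·u, g·v⟩_λ = r·⟨u, v⟩_λ` for all `u, v`; i.e. an invertible `g` acts by left
multiplication as a symplectic similitude of `⟨,⟩_λ` exactly when `τ(g)g` is a nonzero
scalar. -/
theorem statement3 (hn : 1 ≤ n) (ha : ∀ i, 0 < a i)
    (g : Cplus n a) (hg : IsUnit g) (r : ℚ) (hr : r ≠ 0) :
    tau n a g * g = algebraMap ℚ (Cplus n a) r ↔
      ∀ u v : Cplus n a, form n a (g * u) (g * v) = r * form n a u v := by
  have hform : ∀ u v : Cplus n a, form n a (g * u) (g * v)
      = tr n a (lam n a * tau n a u * ((tau n a g * g) * v)) := by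
    intro u v
    unfold form
    rw [tau_mul]
    simp only [mul_assoc]
  constructor
  · intro h u v
    rw [hform, h, ← Algebra.smul_def, mul_smul_comm, tr_smul]
    rfl
  · intro h
    have hz : lam n a * (tau n a g * g - algebraMap ℚ (Cplus n a) r) = 0 := by
      apply nondeg n a ha
      intro y
      have h1 := h 1 y
      rw [hform] at h1
      unfold form at h1
      rw [tau_one, mul_one] at h1
      change trL n a _ = r * trL n a _ at h1
      change trL n a _ = 0
      rw [mul_sub, sub_mul, map_sub, mul_assoc, h1, mul_assoc, ← Algebra.smul_def, mul_smul_comm,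
        map_smul, smul_eq_mul, sub_self]
    have hz' := congrArg Subtype.val hz
    change e n a 0 * e n a 1 * _ = 0 at hz'
    rw [mul_assoc] at hz'
    have h2 := e_cancel n a ha _ _ (e_cancel n a ha _ _ hz')
    exact sub_eq_zero.mp (Subtype.ext h2)
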